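/- If for some n ≡ 1 (mod 6) there exists a balanced edge-coloring of K_n with 6 colors and no rainbow K_4, then there exist infinitely many m with such a balanced 6-coloring of K_m having no rainbow K_4. -/

import Mathlib

/-- An edge-coloring (given as a symmetric function) is balanced if every vertex is
incident to each color the same number of times. -/
def IsBalanced {n ℓ : ℕ} (c : Fin n → Fin n → Fin ℓ) : Prop :=
  (∀ i j, c i j = c j i) ∧
  ∃ t : ℕ, ∀ v : Fin n, ∀ col : Fin ℓ,
    (Finset.univ.filter (fun j => j ≠ v ∧ c v j = col)).card = t

/-- The set `s` is rainbow for the coloring `c`: distinct edges inside `s` get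
distinct colors. -/
def IsRainbowOn {V : Type*} [DecidableEq V] {ℓ : ℕ} (c : V → V → Fin ℓ)
    (s : Finset V) : Prop :=
  ∀ a ∈ s, ∀ b ∈ s, ∀ a' ∈ s, ∀ b' ∈ s,
    a ≠ b → a' ≠ b' → ({a, b} : Finset V) ≠ {a', b'} → c a b ≠ c a' b'

/-- The coloring `c` contains a rainbow copy of K_q. -/
def HasRainbowClique {V : Type*} [DecidableEq V] {ℓ : ℕ} (c : V → V → Fin ℓ)
    (q : ℕ) : Prop :=
  ∃ s : Finset V, s.card = q ∧ IsRainbowOn c s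

theorem IsRainbowOn.image {V W : Type*} [DecidableEq V] [DecidableEq W] {ℓ : ℕ}
    {c : V → V → Fin ℓ} {d : W → W → Fin ℓ} {s : Finset V} {f : V → W}
    (hs : IsRainbowOn c s) (hcd : ∀ x ∈ s, ∀ y ∈ s, x ≠ y → c x y = d (f x) (f y)) :
    IsRainbowOn d (s.image f) := by
  intro _ hfa _ hfb _ hfa' _ hfb' hab hab' hne
  obtain ⟨a, ha, rfl⟩ := Finset.mem_image.1 hfa
  obtain ⟨b, hb, rfl⟩ := Finset.mem_image.1 hfb
  obtain ⟨a', ha', rfl⟩ := Finset.mem_image.1 hfa'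
  obtain ⟨b', hb', rfl⟩ := Finset.mem_image.1 hfb'
  have hab₀ : a ≠ b := fun h => hab (congrArg f h)
  have hab₀' : a' ≠ b' := fun h => hab' (congrArg f h)
  rw [← hcd a ha b hb hab₀, ← hcd a' ha' b' hb' hab₀']
  refine hs a ha b hb a' ha' b' hb' hab₀ hab₀' fun h => hne ?_
  simpa [Finset.image_insert] using congrArg (Finset.image f) h

/-- The lexicographic product of two colorings: pairs in different fibres of the first
projection are colored by `c`, pairs in the same fibre by `d`. -/
def lexColoring {V W : Type*} [DecidableEq V] {ℓ : ℕ} (c : V → V → Fin ℓ)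
    (d : W → W → Fin ℓ) (x y : V × W) : Fin ℓ :=
  if x.1 = y.1 then d x.2 y.2 else c x.1 y.1

theorem not_hasRainbowClique_lexColoring {V W : Type*} [DecidableEq V] [DecidableEq W]
    {ℓ q : ℕ} {c : V → V → Fin ℓ} {d : W → W → Fin ℓ} (hc : ¬ HasRainbowClique c q)
    (hd : ¬ HasRainbowClique d q) : ¬ HasRainbowClique (lexColoring c d) q := by
  rintro ⟨s, hcard, hs⟩
  by_cases hinj : Set.InjOn Prod.fst (s : Set (V × W))
  · refine hc ⟨s.image Prod.fst, (Finset.card_image_of_injOn hinj).trans hcard,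
      hs.image fun x hx y hy hxy => ?_⟩
    exact if_neg fun h => hxy (hinj hx hy h)
  · simp only [Set.InjOn, Finset.mem_coe, not_forall] at hinj
    obtain ⟨x, hx, y, hy, hfst, hxy⟩ := hinj
    have hfibre : ∀ z ∈ s, z.1 = x.1 := by
      intro z hz
      by_contra hzx
      have hzx' : z ≠ x := fun h => hzx (congrArg Prod.fst h)
      have hzy : z.1 ≠ y.1 := hfst ▸ hzx
      have hzy' : z ≠ y := fun h => hzy (congrArg Prod.fst h)
      refine hs z hz x hx z hz y hy hzx' hzy' (fun h => ?_) ?_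
      · have hmem : x ∈ ({z, y} : Finset (V × W)) := h ▸ by simp
        simp only [Finset.mem_insert, Finset.mem_singleton] at hmem
        exact hmem.elim (fun h => hzx' h.symm) hxy
      · simp [lexColoring, hzy, hfst]
    have hsnd : Set.InjOn Prod.snd (s : Set (V × W)) := fun z hz w hw h =>
      Prod.ext ((hfibre z hz).trans (hfibre w hw).symm) h
    refine hd ⟨s.image Prod.snd, (Finset.card_image_of_injOn hsnd).trans hcard,
      hs.image fun z hz w hw _ => ?_⟩
    exact if_pos ((hfibre z hz).trans (hfibre w hw).symm)

theorem card_filter_lexColoring {V W : Type*} [Fintype V] [Fintype W] [DecidableEq V]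
    [DecidableEq W] {ℓ : ℕ} (c : V → V → Fin ℓ) (d : W → W → Fin ℓ) (v : V × W)
    (col : Fin ℓ) :
    (Finset.univ.filter (fun j => j ≠ v ∧ lexColoring c d v j = col)).card =
      (Finset.univ.filter (fun j => j ≠ v.2 ∧ d v.2 j = col)).card +
        (Finset.univ.filter (fun j => j ≠ v.1 ∧ c v.1 j = col)).card * Fintype.card W := by
  obtain ⟨a, b⟩ := v
  have hsplit : Finset.univ.filter (fun j => j ≠ (a, b) ∧ lexColoring c d (a, b) j = col) =
      ({a} ×ˢ Finset.univ.filter (fun j => j ≠ b ∧ d b j = col)) ∪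
        (Finset.univ.filter (fun j => j ≠ a ∧ c a j = col) ×ˢ Finset.univ) := by
    ext ⟨x, y⟩
    by_cases hx : x = a
    · subst hx
      simp [lexColoring]
    · simp [lexColoring, hx, Ne.symm hx]
  rw [hsplit, Finset.card_union_of_disjoint, Finset.card_product, Finset.card_product,
    Finset.card_singleton, one_mul, Finset.card_univ]
  rw [Finset.disjoint_left]
  rintro ⟨x, y⟩ h h'
  simp_all

theorem exists_balanced_no_rainbow_mul {a b ℓ q : ℕ}
    (ha : ∃ c : Fin a → Fin a → Fin ℓ, IsBalanced c ∧ ¬ HasRainbowClique c q)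
    (hb : ∃ c : Fin b → Fin b → Fin ℓ, IsBalanced c ∧ ¬ HasRainbowClique c q) :
    ∃ c : Fin (a * b) → Fin (a * b) → Fin ℓ, IsBalanced c ∧ ¬ HasRainbowClique c q := by
  obtain ⟨c, ⟨hcsymm, t, ht⟩, hc⟩ := ha
  obtain ⟨d, ⟨hdsymm, u, hu⟩, hd⟩ := hb
  let e : Fin (a * b) ≃ Fin a × Fin b := finProdFinEquiv.symm
  refine ⟨fun x y => lexColoring c d (e x) (e y), ⟨fun x y => ?_, u + t * b, fun v col => ?_⟩, ?_⟩
  · simp only [lexColoring, eq_comm (a := (e x).1), hcsymm (e x).1, hdsymm (e x).2]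
  · have h := card_filter_lexColoring c d (e v) col
    rw [hu, ht, Fintype.card_fin] at h
    rw [← h]
    refine Finset.card_equiv e fun j => ?_
    simp
  · rintro ⟨s, hcard, hs⟩
    exact not_hasRainbowClique_lexColoring hc hd
      ⟨s.image e, (Finset.card_image_of_injective s e.injective).trans hcard,
        hs.image fun _ _ _ _ _ => rfl⟩

/-- A balanced 6-coloring of `K₁₃` without a rainbow `K₄`, symmetric under a permutation of
order 3 of the vertices and colors. -/
def coloringThirteen : Fin 13 → Fin 13 → Fin 6 :=
  ![![0, 3, 4, 5, 2, 0, 1, 1, 2, 0, 4, 5, 3],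
    ![3, 0, 4, 3, 5, 1, 5, 4, 1, 2, 0, 2, 0],
    ![4, 4, 0, 5, 3, 3, 2, 0, 5, 2, 1, 1, 0],
    ![5, 3, 5, 0, 0, 4, 4, 0, 1, 3, 1, 2, 2],
    ![2, 5, 3, 0, 0, 0, 2, 3, 4, 4, 5, 1, 1],
    ![0, 1, 3, 4, 0, 0, 1, 5, 4, 5, 2, 3, 2],
    ![1, 5, 2, 4, 2, 1, 0, 3, 3, 5, 0, 0, 4],
    ![1, 4, 0, 0, 3, 5, 3, 0, 2, 1, 2, 4, 5],
    ![2, 1, 5, 1, 4, 4, 3, 2, 0, 0, 3, 0, 5],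
    ![0, 2, 2, 3, 4, 5, 5, 1, 0, 0, 3, 4, 1],
    ![4, 0, 1, 1, 5, 2, 0, 2, 3, 3, 0, 5, 4],
    ![5, 2, 1, 2, 1, 3, 0, 4, 0, 4, 5, 0, 3],
    ![3, 0, 0, 2, 1, 2, 4, 5, 5, 1, 4, 3, 0]]

theorem isBalanced_coloringThirteen : IsBalanced coloringThirteen :=
  ⟨by decide +kernel, 2, by decide +kernel⟩

theorem not_nodup_coloringThirteen (a b c d : Fin 13) (hab : a < b) (hbc : b < c)
    (hcd : c < d) :
    ¬ [coloringThirteen a b, coloringThirteen a c, coloringThirteen a d, coloringThirteen b c,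
      coloringThirteen b d, coloringThirteen c d].Nodup := by
  revert a b c d
  decide +kernel

theorem not_hasRainbowClique_coloringThirteen : ¬ HasRainbowClique coloringThirteen 4 := by
  rintro ⟨s, hcard, hs⟩
  let f := s.orderEmbOfFin hcard
  have hmem : ∀ i, f i ∈ s := s.orderEmbOfFin_mem hcard
  have hne : ∀ i j k l : Fin 4, i ≠ j → k ≠ l → ({i, j} : Finset (Fin 4)) ≠ {k, l} →
      coloringThirteen (f i) (f j) ≠ coloringThirteen (f k) (f l) := by
    intro i j k l hij hkl h
    refine hs _ (hmem i) _ (hmem j) _ (hmem k) _ (hmem l) (f.injective.ne hij)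
      (f.injective.ne hkl) fun h' => h (Finset.image_injective f.injective ?_)
    simpa [Finset.image_insert] using h'
  have hlt : ∀ i j : Fin 4, i < j → f i < f j := fun i j h => f.strictMono h
  refine not_nodup_coloringThirteen (f 0) (f 1) (f 2) (f 3)
    (hlt _ _ (by decide)) (hlt _ _ (by decide)) (hlt _ _ (by decide)) ?_
  simp only [List.nodup_cons, List.mem_cons, List.not_mem_nil, or_false, not_or, List.nodup_nil,
    not_false_eq_true, and_true]
  refine ⟨⟨?_, ?_, ?_, ?_, ?_⟩, ⟨?_, ?_, ?_, ?_⟩, ⟨?_, ?_, ?_⟩, ⟨?_, ?_⟩, ?_⟩ <;>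
    exact hne _ _ _ _ (by decide) (by decide) (by decide)

theorem exists_balanced_no_rainbow_thirteen_pow (k : ℕ) :
    ∃ c : Fin (13 ^ (k + 1)) → Fin (13 ^ (k + 1)) → Fin 6,
      IsBalanced c ∧ ¬ HasRainbowClique c 4 := by
  have hbase : ∃ c : Fin 13 → Fin 13 → Fin 6, IsBalanced c ∧ ¬ HasRainbowClique c 4 :=
    ⟨coloringThirteen, isBalanced_coloringThirteen, not_hasRainbowClique_coloringThirteen⟩
  induction k with
  | zero => exact hbase
  | succ k ih => exact exists_balanced_no_rainbow_mul ih hbase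

/-- If some K_n with n ≡ 1 (mod 6) has a balanced 6-coloring without a rainbow K₄,
then there are infinitely many m for which K_m has one too. -/
theorem infinitely_many_balanced_no_rainbow (n : ℕ) (hn : n % 6 = 1)
    (h : ∃ c : Fin n → Fin n → Fin 6, IsBalanced c ∧ ¬ HasRainbowClique c 4) :
    ∀ N : ℕ, ∃ m : ℕ, N ≤ m ∧
      ∃ c : Fin m → Fin m → Fin 6, IsBalanced c ∧ ¬ HasRainbowClique c 4 := by
  intro N
  exact ⟨13 ^ (N + 1), (Nat.le_succ N).trans (Nat.lt_pow_self (by norm_num)).le,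
    exists_balanced_no_rainbow_thirteen_pow N⟩
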